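/- Let n ≥ 1, let a_1, …, a_n and b_1, …, b_n be real numbers, and for each i let F_i(η) = exp(a_i η + b_i)/(1 + exp(a_i η + b_i)). Let f : ℝ → (0,∞) be a prior density, and for x ∈ {0,1}^n set L(η, x) = ∏_{i=1}^n F_i(η)^{x_i} (1 − F_i(η))^{1 − x_i} f(η), assuming 0 < ∫_ℝ L(η, x) dη < ∞ for the patterns considered. If x, x' ∈ {0,1}^n satisfy ∑_{i=1}^n a_i x_i = ∑_{i=1}^n a_i x'_i, then the normalized posterior densities coincide: L(η, x)/∫ L(u, x) du = L(η, x')/∫ L(u, x') du for every η ∈ ℝ. -/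

import Mathlib

open Finset MeasureTheory

/-- The likelihood of a single binary response under the logistic model. -/
theorem logistic_pow_mul_one_sub_pow (z : ℝ) {k : ℕ} (hk : k = 0 ∨ k = 1) :
    (Real.exp z / (1 + Real.exp z)) ^ k * (1 - Real.exp z / (1 + Real.exp z)) ^ (1 - k) =
      Real.exp (z * k) * (1 + Real.exp z)⁻¹ := by
  have h : 1 + Real.exp z ≠ 0 := by positivity
  rcases hk with rfl | rfl
  · simp
    field_simp
    ring
  · simp [div_eq_mul_inv]

/-- The likelihood of a binary pattern under the two-parameter logistic model factors through
the weighted sum score, up to a factor free of the ability and a factor free of the pattern. -/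
theorem prod_logistic_pow_mul_one_sub_pow {ι : Type*} [Fintype ι] (a b : ι → ℝ) (t : ℝ)
    {x : ι → ℕ} (hx : ∀ i, x i = 0 ∨ x i = 1) :
    ∏ i, (Real.exp (a i * t + b i) / (1 + Real.exp (a i * t + b i))) ^ x i *
        (1 - Real.exp (a i * t + b i) / (1 + Real.exp (a i * t + b i))) ^ (1 - x i) =
      Real.exp (∑ i, b i * x i) * (Real.exp ((∑ i, a i * x i) * t) *
        ∏ i, (1 + Real.exp (a i * t + b i))⁻¹) := by
  rw [Finset.prod_congr rfl fun i _ => logistic_pow_mul_one_sub_pow _ (hx i),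
    Finset.prod_mul_distrib, ← Real.exp_sum, ← mul_assoc, ← Real.exp_add, Finset.sum_mul,
    ← Finset.sum_add_distrib]
  congr 3 with i
  ring

/-- **Sufficiency of the weighted sum score for the 2PL posterior.**
With 2PL item response functions `F i` and prior density `f`, the unnormalized posterior
`L η x = ∏ i, F i η ^ x i * (1 - F i η) ^ (1 - x i) * f η` integrates to a positive finite
constant; if two binary patterns `x, x'` have the same weighted sum `∑ a i x i = ∑ a i x' i`,
then the normalized posterior densities coincide. -/
theorem stmt_7 (n : ℕ) (hn : 1 ≤ n) (a b : Fin n → ℝ)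
    (f : ℝ → ℝ) (hf : ∀ η, 0 < f η)
    (F : Fin n → ℝ → ℝ)
    (hF : ∀ i t, F i t = Real.exp (a i * t + b i) / (1 + Real.exp (a i * t + b i)))
    (L : ℝ → (Fin n → ℕ) → ℝ)
    (hL : ∀ η x, L η x = (∏ i, (F i η) ^ x i * (1 - F i η) ^ (1 - x i)) * f η)
    (x x' : Fin n → ℕ) (hx : ∀ i, x i = 0 ∨ x i = 1) (hx' : ∀ i, x' i = 0 ∨ x' i = 1)
    (hint : Integrable (fun η => L η x)) (hint' : Integrable (fun η => L η x'))
    (hpos : 0 < ∫ η, L η x) (hpos' : 0 < ∫ η, L η x')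
    (hsum : ∑ i, a i * (x i : ℝ) = ∑ i, a i * (x' i : ℝ)) :
    ∀ η, L η x / ∫ u, L u x = L η x' / ∫ u, L u x' := by
  intro η
  let g : ℝ → ℝ := fun t => Real.exp ((∑ i, a i * (x i : ℝ)) * t) *
    (∏ i, (1 + Real.exp (a i * t + b i))⁻¹) * f t
  have key : ∀ t, L t x = Real.exp (∑ i, b i * (x i : ℝ)) * g t := fun t => by
    simp only [hL, hF, prod_logistic_pow_mul_one_sub_pow a b t hx, g, mul_assoc]
  have key' : ∀ t, L t x' = Real.exp (∑ i, b i * (x' i : ℝ)) * g t := fun t => by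
    simp only [hL, hF, prod_logistic_pow_mul_one_sub_pow a b t hx', g, hsum, mul_assoc]
  simp only [key, key', integral_const_mul]
  rw [mul_div_mul_left _ _ (Real.exp_ne_zero _), mul_div_mul_left _ _ (Real.exp_ne_zero _)]
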